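/- arXiv:1209.4974 — 2 statements merged into one kernel-verified Lean document; each statement's English description precedes it below -/
import Mathlib

section
/- Let K̂ ⊂ ℝ² be the isosceles right triangle with vertices (0,0), (1,0), (0,1), let B be an invertible 2×2 real matrix, b ∈ ℝ², F(x̂) = Bx̂ + b, and K = F(K̂). Then there exists a constant C, independent of B, b and of the functions below, such that for every function q₀ : K → ℝ that is bounded and Lipschitz on K, and for all affine functions v, w : ℝ² → ℝ, one has |∫_K q₀(x) v(x) w(x) dx − |K| (q₀ v w)(x_K)| ≤ C ‖B‖ (sup_K |q₀| + Lip(q₀)) ‖v‖_{H¹(K)} ‖w‖_{L²(K)}, where x_K is the barycenter of K, ‖B‖ is the operator norm of B, ‖w‖_{L²(K)} = (∫_K w²)^{1/2} and ‖v‖_{H¹(K)} = (∫_K (v² + |∇v|²))^{1/2}. -/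
noncomputable section
open MeasureTheory

/-- The reference element: the isosceles right triangle with vertices
`(0,0)`, `(1,0)`, `(0,1)` in `ℝ²`. -/
def refTriangle : Set (EuclideanSpace ℝ (Fin 2)) :=
  convexHull ℝ {0, EuclideanSpace.single (0 : Fin 2) (1 : ℝ),
    EuclideanSpace.single (1 : Fin 2) (1 : ℝ)}

/-- Change of variables under an injective affine map. -/
lemma setIntegral_image_affine {E : Type*} [NormedAddCommGroup E] [NormedSpace ℝ E]
    [FiniteDimensional ℝ E] [MeasurableSpace E] [BorelSpace E] (μ : Measure E)
    [μ.IsAddHaarMeasure] (A : E →L[ℝ] E) (hA : Function.Injective A) (a : E) {s : Set E}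
    (hs : MeasurableSet s) (g : E → ℝ) :
    ∫ x in (fun y => A y + a) '' s, g x ∂μ = |A.det| * ∫ y in s, g (A y + a) ∂μ := by
  rw [integral_image_eq_integral_abs_det_fderiv_smul μ hs (f' := fun _ => A)
    (fun x _ => (A.hasFDerivAt.add_const a).hasFDerivWithinAt)
    (fun x _ y _ h => hA (add_right_cancel h))]
  simp only [smul_eq_mul, integral_const_mul]

/-- The Cauchy–Schwarz inequality on a compact set, for nonnegative continuous functions. -/
lemma setIntegral_mul_le_sqrt_mul_sqrt {X : Type*} [TopologicalSpace X] [MeasurableSpace X]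
    [OpensMeasurableSpace X] [T2Space X] {μ : Measure X} [IsFiniteMeasureOnCompacts μ]
    {K : Set X} (hK : IsCompact K) {f g : X → ℝ}
    (hf : ContinuousOn f K) (hg : ContinuousOn g K)
    (hf0 : ∀ x, 0 ≤ f x) (hg0 : ∀ x, 0 ≤ g x) :
    ∫ x in K, f x * g x ∂μ ≤ √(∫ x in K, f x ^ 2 ∂μ) * √(∫ x in K, g x ^ 2 ∂μ) := by
  have memLp {h : X → ℝ} (hh : ContinuousOn h K) :
      MemLp h (ENNReal.ofReal 2) (μ.restrict K) := by
    rw [ENNReal.ofReal_ofNat, memLp_two_iff_integrable_sq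
      (hh.aestronglyMeasurable_of_isCompact hK hK.measurableSet)]
    exact (hh.pow 2).integrableOn_compact hK
  have key := integral_mul_le_Lp_mul_Lq_of_nonneg Real.HolderConjugate.two_two
    (.of_forall hf0) (.of_forall hg0) (memLp hf) (memLp hg)
  simpa only [Real.rpow_two, ← Real.sqrt_eq_rpow] using key

lemma isCompact_refTriangle : IsCompact refTriangle :=
  Set.Finite.isCompact_convexHull ℝ (by simp)

lemma norm_le_one_of_mem_refTriangle {x : EuclideanSpace ℝ (Fin 2)} (hx : x ∈ refTriangle) :
    ‖x‖ ≤ 1 := by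
  have hsub : refTriangle ⊆ Metric.closedBall 0 1 := by
    refine convexHull_min ?_ (convex_closedBall 0 1)
    rintro y (rfl | rfl | rfl) <;> simp
  simpa using hsub hx

lemma barycenter_mem_refTriangle :
    (3 : ℝ)⁻¹ • (EuclideanSpace.single (0 : Fin 2) (1 : ℝ) +
      EuclideanSpace.single (1 : Fin 2) (1 : ℝ)) ∈ refTriangle := by
  have h0 : (0 : EuclideanSpace ℝ (Fin 2)) ∈ refTriangle := subset_convexHull ℝ _ (by simp)
  have h1 : EuclideanSpace.single (0 : Fin 2) (1 : ℝ) ∈ refTriangle :=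
    subset_convexHull ℝ _ (by simp)
  have h2 : EuclideanSpace.single (1 : Fin 2) (1 : ℝ) ∈ refTriangle :=
    subset_convexHull ℝ _ (by simp)
  have hconv : Convex ℝ refTriangle := convex_convexHull ℝ _
  have hmid := hconv h1 h2 (a := 1 / 2) (b := 1 / 2) (by norm_num) (by norm_num) (by norm_num)
  convert hconv h0 hmid (a := 1 / 3) (b := 2 / 3) (by norm_num) (by norm_num) (by norm_num)
    using 1
  module

/-- The linear part of the affine map that permutes the vertices of `refTriangle` cyclically. -/
def refRotation : EuclideanSpace ℝ (Fin 2) →L[ℝ] EuclideanSpace ℝ (Fin 2) :=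
  LinearMap.toContinuousLinearMap
    { toFun := fun x => !₂[-(x 0 + x 1), x 0]
      map_add' := fun x y => by ext i; fin_cases i <;> simp; ring
      map_smul' := fun c x => by ext i; fin_cases i <;> simp; ring }

lemma refRotation_apply (x : EuclideanSpace ℝ (Fin 2)) :
    refRotation x = !₂[-(x 0 + x 1), x 0] := rfl

lemma refRotation_iterate_three (x : EuclideanSpace ℝ (Fin 2)) :
    refRotation (refRotation (refRotation x)) = x := by
  ext i; fin_cases i <;> simp [refRotation_apply]

lemma injective_refRotation : Function.Injective refRotation := fun x y h => by
  rw [← refRotation_iterate_three x, h, refRotation_iterate_three]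

lemma det_refRotation : refRotation.det = 1 := by
  have hcube : refRotation.toLinearMap * (refRotation.toLinearMap * refRotation.toLinearMap)
      = 1 := LinearMap.ext refRotation_iterate_three
  have hdet := congrArg LinearMap.det hcube
  simp only [map_mul, map_one] at hdet
  have hodd : Odd 3 := by decide
  refine hodd.pow_injective ?_
  change LinearMap.det refRotation.toLinearMap ^ 3 = 1 ^ 3
  linarith

lemma image_refRotation_add :
    (fun x => refRotation x + EuclideanSpace.single (0 : Fin 2) (1 : ℝ)) '' refTriangle =
      refTriangle := by
  let T : EuclideanSpace ℝ (Fin 2) →ᵃ[ℝ] EuclideanSpace ℝ (Fin 2) :=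
    refRotation.toLinearMap.toAffineMap +
      AffineMap.const ℝ _ (EuclideanSpace.single (0 : Fin 2) (1 : ℝ))
  have h0 : T 0 = EuclideanSpace.single (0 : Fin 2) (1 : ℝ) := by simp [T]
  have h1 : T (EuclideanSpace.single (0 : Fin 2) (1 : ℝ)) =
      EuclideanSpace.single (1 : Fin 2) (1 : ℝ) := by
    ext i; fin_cases i <;> simp [T, refRotation_apply]
  have h2 : T (EuclideanSpace.single (1 : Fin 2) (1 : ℝ)) = 0 := by
    ext i; fin_cases i <;> simp [T, refRotation_apply]
  change T '' convexHull ℝ _ = _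
  rw [AffineMap.image_convexHull, Set.image_insert_eq, Set.image_pair, h0, h1, h2, refTriangle]
  congr 1
  ext x
  simp only [Set.mem_insert_iff, Set.mem_singleton_iff]
  tauto

lemma setIntegral_refTriangle_comp_rotation (g : EuclideanSpace ℝ (Fin 2) → ℝ) :
    ∫ x in refTriangle, g (refRotation x + EuclideanSpace.single (0 : Fin 2) (1 : ℝ)) =
      ∫ x in refTriangle, g x := by
  have h := setIntegral_image_affine volume refRotation injective_refRotation
    (EuclideanSpace.single (0 : Fin 2) (1 : ℝ)) isCompact_refTriangle.measurableSet g
  rw [image_refRotation_add, det_refRotation, abs_one, one_mul] at h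
  exact h.symm

/-- Barycenter quadrature on the reference triangle is exact for affine functions. -/
lemma setIntegral_refTriangle_affine (l : EuclideanSpace ℝ (Fin 2) →L[ℝ] ℝ) (c : ℝ) :
    ∫ x in refTriangle, (l x + c) = volume.real refTriangle *
      (l ((3 : ℝ)⁻¹ • (EuclideanSpace.single (0 : Fin 2) (1 : ℝ) +
        EuclideanSpace.single (1 : Fin 2) (1 : ℝ))) + c) := by
  let e : EuclideanSpace ℝ (Fin 2) := EuclideanSpace.single (0 : Fin 2) (1 : ℝ)
  let T : EuclideanSpace ℝ (Fin 2) → EuclideanSpace ℝ (Fin 2) := fun x => refRotation x + e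
  have hT : Continuous T := by fun_prop
  have hint {f : EuclideanSpace ℝ (Fin 2) → ℝ} (hf : Continuous f) :
      IntegrableOn f refTriangle := hf.continuousOn.integrableOn_compact isCompact_refTriangle
  have hone : ∫ x in refTriangle, (l (T x) + c) = ∫ x in refTriangle, (l x + c) :=
    setIntegral_refTriangle_comp_rotation fun x => l x + c
  have htwo : ∫ x in refTriangle, (l (T (T x)) + c) = ∫ x in refTriangle, (l (T x) + c) :=
    setIntegral_refTriangle_comp_rotation fun x => l (T x) + c
  have horbit (x : EuclideanSpace ℝ (Fin 2)) : x + T x + T (T x) =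
      EuclideanSpace.single (0 : Fin 2) (1 : ℝ) + EuclideanSpace.single (1 : Fin 2) (1 : ℝ) := by
    ext i; fin_cases i <;> simp [T, e, refRotation_apply] <;> ring
  have hsum : ∫ x in refTriangle, ((l x + c) + (l (T x) + c) + (l (T (T x)) + c)) =
      (∫ x in refTriangle, (l x + c)) + (∫ x in refTriangle, (l (T x) + c)) +
        ∫ x in refTriangle, (l (T (T x)) + c) := by
    rw [integral_add (hint (by fun_prop)) (hint (by fun_prop)),
      integral_add (hint (by fun_prop)) (hint (by fun_prop))]
  have hconst (x : EuclideanSpace ℝ (Fin 2)) :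
      (l x + c) + (l (T x) + c) + (l (T (T x)) + c) =
        l (EuclideanSpace.single (0 : Fin 2) (1 : ℝ) +
          EuclideanSpace.single (1 : Fin 2) (1 : ℝ)) + 3 * c := by
    rw [← horbit x, map_add l (x + T x), map_add l x]; ring
  simp only [hconst, setIntegral_const, smul_eq_mul] at hsum
  rw [map_smul, smul_eq_mul]
  linarith

/-- Barycenter quadrature on an affine image of the reference triangle is exact for affine
functions. -/
lemma setIntegral_image_refTriangle_affine
    (B : EuclideanSpace ℝ (Fin 2) →L[ℝ] EuclideanSpace ℝ (Fin 2)) (hB : Function.Injective B)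
    (b : EuclideanSpace ℝ (Fin 2)) (l : EuclideanSpace ℝ (Fin 2) →L[ℝ] ℝ) (c : ℝ) :
    ∫ x in (fun y => B y + b) '' refTriangle, (l x + c) =
      volume.real ((fun y => B y + b) '' refTriangle) *
        (l (B ((3 : ℝ)⁻¹ • (EuclideanSpace.single (0 : Fin 2) (1 : ℝ) +
          EuclideanSpace.single (1 : Fin 2) (1 : ℝ))) + b) + c) := by
  have hvol := setIntegral_image_affine volume B hB b isCompact_refTriangle.measurableSet
    fun _ => 1
  simp only [setIntegral_const, smul_eq_mul, mul_one] at hvol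
  have h := setIntegral_refTriangle_affine (l.comp B) (l b + c)
  simp only [ContinuousLinearMap.comp_apply] at h
  rw [setIntegral_image_affine volume B hB b isCompact_refTriangle.measurableSet, hvol]
  simp only [map_add, add_assoc] at h ⊢
  rw [h, mul_assoc]

/-- Barycenter quadrature error estimate (Lemma 3.1): there is a
universal constant `C` such that for every invertible affine image `K = B(K̂) + b` of
the reference triangle, every bounded Lipschitz `q₀` on `K`, and all affine functions
`v, w` (with gradients `gv, gw`),
`|∫_K q₀ v w − |K| (q₀ v w)(x_K)| ≤ C ‖B‖ (sup_K |q₀| + Lip(q₀)) ‖v‖_{H¹(K)} ‖w‖_{L²(K)}`,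
where `x_K` is the barycenter of `K`. -/
theorem stmt0 :
    ∃ C : ℝ, 0 < C ∧
      ∀ (B : EuclideanSpace ℝ (Fin 2) →L[ℝ] EuclideanSpace ℝ (Fin 2)),
        Function.Bijective B →
      ∀ b : EuclideanSpace ℝ (Fin 2),
      ∀ K : Set (EuclideanSpace ℝ (Fin 2)), K = (fun y => B y + b) '' refTriangle →
      ∀ xK : EuclideanSpace ℝ (Fin 2),
        xK = (3 : ℝ)⁻¹ • ((B 0 + b) + (B (EuclideanSpace.single (0 : Fin 2) (1 : ℝ)) + b) +
          (B (EuclideanSpace.single (1 : Fin 2) (1 : ℝ)) + b)) →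
      ∀ (q₀ : EuclideanSpace ℝ (Fin 2) → ℝ) (M : ℝ) (L : NNReal),
        (∀ x ∈ K, |q₀ x| ≤ M) → LipschitzOnWith L q₀ K →
      ∀ (gv gw : EuclideanSpace ℝ (Fin 2)) (cv cw : ℝ)
        (v w : EuclideanSpace ℝ (Fin 2) → ℝ),
        (∀ x, v x = gv 0 * x 0 + gv 1 * x 1 + cv) →
        (∀ x, w x = gw 0 * x 0 + gw 1 * x 1 + cw) →
        |(∫ x in K, q₀ x * v x * w x) - (volume K).toReal * (q₀ xK * v xK * w xK)| ≤
          C * ‖B‖ * (M + (L : ℝ)) *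
            Real.sqrt (∫ x in K, ((v x) ^ 2 + ((gv 0) ^ 2 + (gv 1) ^ 2))) *
            Real.sqrt (∫ x in K, (w x) ^ 2) := by
  refine ⟨2, two_pos, ?_⟩
  intro B hB b K hK xK hxK q₀ M L hM hL gv gw cv cw v w hv hw
  have hinner (g x : EuclideanSpace ℝ (Fin 2)) :
      innerSL ℝ g x = g 0 * x 0 + g 1 * x 1 := by
    simp [PiLp.inner_apply, Fin.sum_univ_two, mul_comm]
  replace hv (x) : v x = innerSL ℝ gv x + cv := by rw [hv, hinner]
  replace hw (x) : w x = innerSL ℝ gw x + cw := by rw [hw, hinner]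
  have hnorm : gv 0 ^ 2 + gv 1 ^ 2 = ‖gv‖ ^ 2 := by
    simp [EuclideanSpace.norm_sq_eq, Fin.sum_univ_two]
  have hxK' : xK = B ((3 : ℝ)⁻¹ • (EuclideanSpace.single (0 : Fin 2) (1 : ℝ) +
      EuclideanSpace.single (1 : Fin 2) (1 : ℝ))) + b := by
    rw [hxK, map_zero, map_smul, map_add]; module
  have hxK_mem : xK ∈ K := by
    rw [hK, hxK']; exact ⟨_, barycenter_mem_refTriangle, rfl⟩
  have hKc : IsCompact K := by
    rw [hK]; exact isCompact_refTriangle.image (by fun_prop)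
  have hM0 : 0 ≤ M := (abs_nonneg _).trans (hM xK hxK_mem)
  have hdist (x) (hx : x ∈ K) : ‖x - xK‖ ≤ 2 * ‖B‖ := by
    obtain ⟨y, hy, rfl⟩ := hK ▸ hx
    rw [hxK', add_sub_add_right_eq_sub, ← map_sub]
    refine (B.le_opNorm _).trans ?_
    rw [mul_comm]
    gcongr
    refine (norm_sub_le _ _).trans ?_
    linarith [norm_le_one_of_mem_refTriangle hy,
      norm_le_one_of_mem_refTriangle barycenter_mem_refTriangle]
  have hvc : Continuous v := by rw [funext hv]; fun_prop
  have hwc : Continuous w := by rw [funext hw]; fun_prop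
  have hqc : ContinuousOn q₀ K := hL.continuousOn
  have hint {f : EuclideanSpace ℝ (Fin 2) → ℝ} (hf : ContinuousOn f K) : IntegrableOn f K :=
    hf.integrableOn_compact hKc
  have hwint : ∫ x in K, w x = volume.real K * w xK := by
    simp only [hw]
    rw [hK, hxK', setIntegral_image_refTriangle_affine B hB.1 b]
  have herror : (∫ x in K, q₀ x * v x * w x) - (volume K).toReal * (q₀ xK * v xK * w xK) =
      ∫ x in K, ((q₀ x - q₀ xK) * v x + q₀ xK * (v x - v xK)) * w x := by
    have hsplit (x) : ((q₀ x - q₀ xK) * v x + q₀ xK * (v x - v xK)) * w x =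
        q₀ x * v x * w x - q₀ xK * v xK * w x := by ring
    simp only [hsplit]
    rw [integral_sub (hint (by fun_prop)) (hint (by fun_prop)), integral_const_mul, hwint,
      Measure.real]
    ring
  have hpoint (x) (hx : x ∈ K) :
      ‖((q₀ x - q₀ xK) * v x + q₀ xK * (v x - v xK)) * w x‖ ≤
        2 * ‖B‖ * (M + L) * (√(v x ^ 2 + ‖gv‖ ^ 2) * |w x|) := by
    have hq : |q₀ x - q₀ xK| ≤ L * (2 * ‖B‖) := by
      have h := hL.dist_le_mul x hx xK hxK_mem
      rw [Real.dist_eq, dist_eq_norm] at h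
      exact h.trans (by gcongr; exact hdist x hx)
    have hvd : |v x - v xK| ≤ ‖gv‖ * (2 * ‖B‖) := by
      have h : v x - v xK = inner ℝ gv (x - xK) := by
        rw [hv, hv, ← innerSL_apply_apply ℝ, map_sub]; ring
      rw [h]
      exact (abs_real_inner_le_norm _ _).trans (by gcongr; exact hdist x hx)
    have hv_le : |v x| ≤ √(v x ^ 2 + ‖gv‖ ^ 2) :=
      Real.abs_le_sqrt (le_add_of_nonneg_right (sq_nonneg _))
    have hg_le : ‖gv‖ ≤ √(v x ^ 2 + ‖gv‖ ^ 2) :=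
      Real.le_sqrt_of_sq_le (le_add_of_nonneg_left (sq_nonneg _))
    rw [norm_mul, Real.norm_eq_abs, Real.norm_eq_abs, ← mul_assoc]
    gcongr
    calc |(q₀ x - q₀ xK) * v x + q₀ xK * (v x - v xK)|
        ≤ |q₀ x - q₀ xK| * |v x| + |q₀ xK| * |v x - v xK| := by
          rw [← abs_mul, ← abs_mul]; exact abs_add_le _ _
      _ ≤ L * (2 * ‖B‖) * √(v x ^ 2 + ‖gv‖ ^ 2) +
            M * (√(v x ^ 2 + ‖gv‖ ^ 2) * (2 * ‖B‖)) := by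
          have hqM := hM xK hxK_mem
          have hvd' := hvd.trans (mul_le_mul_of_nonneg_right hg_le (by positivity))
          gcongr
      _ = 2 * ‖B‖ * (M + L) * √(v x ^ 2 + ‖gv‖ ^ 2) := by ring
  have hcs := setIntegral_mul_le_sqrt_mul_sqrt (μ := volume) hKc
    (f := fun x => √(v x ^ 2 + ‖gv‖ ^ 2)) (g := fun x => |w x|)
    (by fun_prop) (by fun_prop) (fun _ => Real.sqrt_nonneg _) (fun _ => abs_nonneg _)
  simp only [sq_abs, Real.sq_sqrt (add_nonneg (sq_nonneg (v _)) (sq_nonneg ‖gv‖))] at hcs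
  rw [herror, hnorm, ← Real.norm_eq_abs, mul_assoc (2 * ‖B‖ * (M + L))]
  refine (norm_integral_le_of_norm_le (hint (by fun_prop))
    (ae_restrict_of_forall_mem hKc.measurableSet hpoint)).trans ?_
  rw [integral_const_mul]
  gcongr
end
end

section
/- Let d ≥ 1, let (Ω, ℱ, ℙ) be a probability space, and let q : ℝ^d × Ω → ℝ be jointly measurable and uniformly bounded, with E q(x,·) = 0 and E[q(x,·) q(y,·)] = R(x − y) for all x, y ∈ ℝ^d, for a correlation function R ∈ L¹(ℝ^d). Then for every ψ ∈ L¹(ℝ^d) ∩ L²(ℝ^d) and every ε > 0, the random variable X^ε(ω) = ∫_{ℝ^d} q(x/ε, ω) ψ(x) dx satisfies E[(X^ε)²] ≤ ε^d ‖R‖_{L¹(ℝ^d)} ‖ψ‖²_{L²(ℝ^d)}. -/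
noncomputable section
open MeasureTheory

/-- Schur-type bound for the quadratic form of a translation-invariant kernel on `L²`. -/
theorem integral_prod_kernel_sub_mul_le {E : Type*} [NormedAddCommGroup E] [MeasurableSpace E]
    [BorelSpace E] [SecondCountableTopology E] {μ : Measure E} [SFinite μ] [μ.IsAddLeftInvariant]
    [μ.IsNegInvariant] {K f : E → ℝ} (hK : Integrable K μ)
    (hf : Integrable (fun x => f x ^ 2) μ) :
    ∫ p : E × E, K (p.1 - p.2) * (f p.1 * f p.2) ∂(μ.prod μ) ≤
      (∫ z, |K z| ∂μ) * ∫ x, f x ^ 2 ∂μ := by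
  have hright : ∀ {G : E → ℝ}, Integrable G μ →
      Integrable (fun p : E × E => f p.2 ^ 2 * G (p.1 - p.2)) (μ.prod μ) ∧
      ∫ p : E × E, f p.2 ^ 2 * G (p.1 - p.2) ∂(μ.prod μ) =
        (∫ x, f x ^ 2 ∂μ) * ∫ z, G z ∂μ := by
    intro G hG
    have hint := hf.convolution_integrand (ContinuousLinearMap.mul ℝ ℝ) hG
    have heq := integral_convolution (ContinuousLinearMap.mul ℝ ℝ) hf hG
    simp only [ContinuousLinearMap.mul_apply'] at hint heq
    refine ⟨hint, ?_⟩
    rw [integral_prod _ hint, ← heq]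
    rfl
  obtain ⟨hi₂, he₂⟩ := hright hK.abs
  obtain ⟨hi, he⟩ := hright hK.abs.comp_neg
  have hi₁ : Integrable (fun p : E × E => f p.1 ^ 2 * |K (p.1 - p.2)|) (μ.prod μ) := by
    simpa [Function.comp_def] using hi.swap
  have he₁ : ∫ p : E × E, f p.1 ^ 2 * |K (p.1 - p.2)| ∂(μ.prod μ) =
      (∫ x, f x ^ 2 ∂μ) * ∫ z, |K z| ∂μ := by
    rw [integral_neg_eq_self (fun z => |K z|) μ] at he
    rw [← he, ← integral_prod_swap]
    simp
  calc ∫ p : E × E, K (p.1 - p.2) * (f p.1 * f p.2) ∂(μ.prod μ)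
      ≤ ∫ p : E × E, |K (p.1 - p.2) * (f p.1 * f p.2)| ∂(μ.prod μ) :=
        (le_abs_self _).trans (abs_integral_le_integral_abs)
    _ ≤ ∫ p : E × E, (f p.1 ^ 2 * |K (p.1 - p.2)| + f p.2 ^ 2 * |K (p.1 - p.2)|) / 2
          ∂(μ.prod μ) := by
        refine integral_mono_of_nonneg (.of_forall fun p => abs_nonneg _)
          ((hi₁.add hi₂).div_const 2) (.of_forall fun p => ?_)
        have h : |f p.1 * f p.2| ≤ (f p.1 ^ 2 + f p.2 ^ 2) / 2 :=
          abs_le.2 ⟨by nlinarith [sq_nonneg (f p.1 + f p.2)],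
            by nlinarith [sq_nonneg (f p.1 - f p.2)]⟩
        calc |K (p.1 - p.2) * (f p.1 * f p.2)|
            = |K (p.1 - p.2)| * |f p.1 * f p.2| := abs_mul _ _
          _ ≤ |K (p.1 - p.2)| * ((f p.1 ^ 2 + f p.2 ^ 2) / 2) := by gcongr
          _ = _ := by ring
    _ = (∫ z, |K z| ∂μ) * ∫ x, f x ^ 2 ∂μ := by
        rw [integral_div, integral_add hi₁ hi₂, he₁, he₂]
        ring

/-- The second moment of `∫ u x ω * f x dx` is the quadratic form of the second-moment kernel
of the bounded random field `u`. -/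
theorem integral_sq_integral_mul_eq {E Ω : Type*} [MeasurableSpace E] [MeasurableSpace Ω]
    {μ : Measure E} [SFinite μ] {P : Measure Ω} [IsFiniteMeasure P] {u : E → Ω → ℝ}
    (hu : Measurable (fun p : E × Ω => u p.1 p.2)) {M : ℝ} (hM : ∀ x ω, |u x ω| ≤ M)
    {f : E → ℝ} (hf : Integrable f μ) :
    ∫ ω, (∫ x, u x ω * f x ∂μ) ^ 2 ∂P =
      ∫ p : E × E, (∫ ω, u p.1 ω * u p.2 ω ∂P) * (f p.1 * f p.2) ∂(μ.prod μ) := by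
  have hmeas : Measurable (fun t : Ω × (E × E) => u t.2.1 t.1 * u t.2.2 t.1) :=
    (hu.comp (measurable_snd.fst.prodMk measurable_fst)).mul
      (hu.comp (measurable_snd.snd.prodMk measurable_fst))
  have hint : Integrable
      (fun t : Ω × (E × E) => u t.2.1 t.1 * u t.2.2 t.1 * (f t.2.1 * f t.2.2))
      (P.prod (μ.prod μ)) := by
    refine ((hf.mul_prod hf).comp_snd P).bdd_mul (c := M * M) hmeas.aestronglyMeasurable
      (.of_forall fun t => ?_)
    rw [Real.norm_eq_abs, abs_mul]
    exact mul_le_mul (hM _ _) (hM _ _) (abs_nonneg _) ((abs_nonneg _).trans (hM t.2.1 t.1))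
  calc ∫ ω, (∫ x, u x ω * f x ∂μ) ^ 2 ∂P
      = ∫ ω, ∫ p : E × E, u p.1 ω * u p.2 ω * (f p.1 * f p.2) ∂(μ.prod μ) ∂P := by
        congr 1 with ω
        rw [sq, ← integral_prod_mul]
        congr 1 with p
        ring
    _ = ∫ p : E × E, ∫ ω, u p.1 ω * u p.2 ω * (f p.1 * f p.2) ∂P ∂(μ.prod μ) :=
        integral_integral_swap hint
    _ = _ := by simp only [integral_mul_const]

/-- Short-range-correlation variance bound (3.11): if the mean-zero,
uniformly bounded, jointly measurable random field `q` has integrable correlation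
function `R` (`E[q(x)q(y)] = R(x−y)`), then for every `ψ ∈ L¹ ∩ L²` and every `ε > 0`,
`E[(X^ε)²] ≤ ε^d ‖R‖_{L¹} ‖ψ‖_{L²}²` where `X^ε(ω) = ∫ q(x/ε,ω) ψ(x) dx`. -/
theorem stmt4 (d : ℕ) (hd : 1 ≤ d)
    (Ω : Type*) [MeasureSpace Ω] [IsProbabilityMeasure (volume : Measure Ω)]
    (q : EuclideanSpace ℝ (Fin d) → Ω → ℝ) (R : EuclideanSpace ℝ (Fin d) → ℝ)
    (hqm : Measurable (fun p : EuclideanSpace ℝ (Fin d) × Ω => q p.1 p.2))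
    (M : ℝ) (hqb : ∀ x ω, |q x ω| ≤ M)
    (hmean : ∀ x, ∫ ω, q x ω = 0)
    (hcov : ∀ x y : EuclideanSpace ℝ (Fin d), ∫ ω, q x ω * q y ω = R (x - y))
    (hR : Integrable R)
    (ψ : EuclideanSpace ℝ (Fin d) → ℝ)
    (hψ1 : Integrable ψ) (hψ2 : Integrable (fun x => ψ x ^ 2))
    (ε : ℝ) (hε : 0 < ε) :
    ∫ ω, (∫ x, q (ε⁻¹ • x) ω * ψ x) ^ 2 ≤
      ε ^ d * (∫ z, |R z|) * ∫ x, ψ x ^ 2 := by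
  have hu : Measurable (fun p : EuclideanSpace ℝ (Fin d) × Ω => q (ε⁻¹ • p.1) p.2) :=
    hqm.comp ((measurable_fst.const_smul ε⁻¹).prodMk measurable_snd)
  rw [integral_sq_integral_mul_eq hu (fun x ω => hqb (ε⁻¹ • x) ω) hψ1]
  simp only [hcov, ← smul_sub]
  refine (integral_prod_kernel_sub_mul_le (hR.comp_smul (inv_ne_zero hε.ne')) hψ2).trans_eq ?_
  rw [Measure.integral_comp_inv_smul_of_nonneg volume (fun z => |R z|) hε.le,
    finrank_euclideanSpace_fin, smul_eq_mul]
end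
end
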